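/- Fix 0 ≤ p < 1 and real constants c₁, c₂ > 0 with c₁ < 4. Let R : ℕ → ℝ satisfy R(1) = 1 and, for n ≥ 2, R(n) = 1 + (1/H_n)·Σ_{k=1}^{n−1} R(k)/(n − k). Let Rp : ℕ → ℝ satisfy Rp(0) = 0 and, for n ≥ 1, Rp(n) = 1 + p·Rp(n−1) + ((1−p)/H_n)·Σ_{k=1}^{n−1} Rp(k)/(n − k). Suppose that c₁·H_n² ≤ R(n) ≤ c₂·H_n² for all n ≥ 40, and that the bounds ((4c₁/9)/(1 − (1 − 0.214·c₁)·p))·H_{40}² ≤ Rp(40) ≤ (c₂/(1−p))·H_{40}² hold at n = 40. Then for all n ≥ 40, ((4c₁/9)/(1 − (1 − 0.214·c₁)·p))·H_n² ≤ Rp(n) ≤ (c₂/(1−p))·H_n². -/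

import Mathlib

open Finset

/-- The `n`-th harmonic number `H_n = ∑_{k=1}^n 1/k`, with `H 0 = 0`. -/
noncomputable def H (n : ℕ) : ℝ := ∑ k ∈ Finset.Icc 1 n, (1 : ℝ) / k

lemma H_zero : H 0 = 0 := by simp [H]

lemma H_succ (n : ℕ) : H (n + 1) = H n + 1 / ((n : ℝ) + 1) := by
  unfold H
  rw [Finset.sum_Icc_succ_top (by omega)]
  push_cast
  rfl

lemma H_mono : Monotone H := by
  refine monotone_nat_of_le_succ fun n => ?_
  rw [H_succ]
  have : (0 : ℝ) ≤ 1 / ((n : ℝ) + 1) := by positivity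
  linarith

lemma H_nonneg (n : ℕ) : 0 ≤ H n := H_zero ▸ H_mono (Nat.zero_le n)

lemma one_le_H {n : ℕ} (hn : 1 ≤ n) : 1 ≤ H n := by
  have h : H 1 = 1 := by simp [H]
  exact h ▸ H_mono hn

lemma H_le (n : ℕ) : H n ≤ n := by
  induction n with
  | zero => simp [H_zero]
  | succ n ih =>
    rw [H_succ]
    push_cast
    have : 1 / ((n : ℝ) + 1) ≤ 1 := by
      rw [div_le_one (by positivity)]
      have : (0 : ℝ) ≤ n := by positivity
      linarith
    linarith

lemma tendsto_H : Filter.Tendsto H Filter.atTop Filter.atTop := by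
  refine Real.tendsto_sum_range_one_div_nat_succ_atTop.congr fun n => ?_
  induction n with
  | zero => simp [H_zero]
  | succ n ih => rw [Finset.sum_range_succ, ih, H_succ]

/-- The second-order harmonic number `∑_{k=1}^n 1/k²`. -/
noncomputable def harmonicSq (n : ℕ) : ℝ := ∑ k ∈ range n, 1 / ((k : ℝ) + 1) ^ 2

/-- The Euler sum `∑_{k=1}^n H_k/k²`. -/
noncomputable def eulerSum (n : ℕ) : ℝ := ∑ k ∈ range n, H (k + 1) / ((k : ℝ) + 1) ^ 2

lemma harmonicSq_succ (n : ℕ) : harmonicSq (n + 1) = harmonicSq n + 1 / ((n : ℝ) + 1) ^ 2 :=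
  Finset.sum_range_succ _ _

lemma eulerSum_succ (n : ℕ) :
    eulerSum (n + 1) = eulerSum n + H (n + 1) / ((n : ℝ) + 1) ^ 2 :=
  Finset.sum_range_succ _ _

lemma tendsto_harmonicSq :
    Filter.Tendsto harmonicSq Filter.atTop (nhds (Real.pi ^ 2 / 6)) := by
  have h := (Filter.tendsto_add_atTop_iff_nat 1).2 hasSum_zeta_two.tendsto_sum_nat
  refine h.congr fun n => ?_
  rw [Finset.sum_range_succ']
  simp [harmonicSq]

lemma harmonicSq_mono : Monotone harmonicSq := by
  refine monotone_nat_of_le_succ fun n => ?_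
  rw [harmonicSq_succ]
  have : (0 : ℝ) ≤ 1 / ((n : ℝ) + 1) ^ 2 := by positivity
  linarith

lemma harmonicSq_le (n : ℕ) : harmonicSq n ≤ Real.pi ^ 2 / 6 :=
  harmonicSq_mono.ge_of_tendsto tendsto_harmonicSq n

lemma one_le_harmonicSq {n : ℕ} (hn : 1 ≤ n) : 1 ≤ harmonicSq n := by
  have h : harmonicSq 1 = 1 := by simp [harmonicSq]
  exact h ▸ harmonicSq_mono hn

lemma harmonicSq_add_inv_succ_le (n : ℕ) :
    harmonicSq n + 1 / ((n : ℝ) + 1) ≤ Real.pi ^ 2 / 6 := by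
  have hmono : Monotone fun n : ℕ => harmonicSq n + 1 / ((n : ℝ) + 1) := by
    refine monotone_nat_of_le_succ fun n => ?_
    simp only [harmonicSq_succ]
    push_cast
    have h : 1 / ((n : ℝ) + 1) ^ 2 + 1 / ((n : ℝ) + 1 + 1) - 1 / ((n : ℝ) + 1)
        = 1 / (((n : ℝ) + 1) ^ 2 * ((n : ℝ) + 2)) := by
      field_simp
      ring
    have : (0 : ℝ) ≤ 1 / (((n : ℝ) + 1) ^ 2 * ((n : ℝ) + 2)) := by positivity
    linarith
  have hlim := tendsto_harmonicSq.add (tendsto_one_div_add_atTop_nhds_zero_nat (𝕜 := ℝ))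
  rw [add_zero] at hlim
  exact hmono.ge_of_tendsto hlim n

lemma le_harmonicSq_succ_add_inv (n : ℕ) :
    Real.pi ^ 2 / 6 ≤ harmonicSq (n + 1) + 1 / ((n : ℝ) + 1) := by
  have hanti : Antitone fun n : ℕ => harmonicSq (n + 1) + 1 / ((n : ℝ) + 1) := by
    refine antitone_nat_of_succ_le fun n => ?_
    simp only [harmonicSq_succ]
    push_cast
    have h : 1 / ((n : ℝ) + 1) - 1 / ((n : ℝ) + 1 + 1) - 1 / ((n : ℝ) + 1 + 1) ^ 2
        = 1 / (((n : ℝ) + 1) * ((n : ℝ) + 2) ^ 2) := by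
      field_simp
      ring
    have : (0 : ℝ) ≤ 1 / (((n : ℝ) + 1) * ((n : ℝ) + 2) ^ 2) := by positivity
    linarith
  have hlim := ((Filter.tendsto_add_atTop_iff_nat 1).2 tendsto_harmonicSq).add
    (tendsto_one_div_add_atTop_nhds_zero_nat (𝕜 := ℝ))
  rw [add_zero] at hlim
  exact hanti.le_of_tendsto hlim n

lemma eulerSum_nonneg (n : ℕ) : 0 ≤ eulerSum n :=
  Finset.sum_nonneg fun k _ => div_nonneg (H_nonneg _) (by positivity)

lemma harmonicSq_le_eulerSum (n : ℕ) : harmonicSq n ≤ eulerSum n :=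
  Finset.sum_le_sum fun k _ => by
    have := one_le_H (show 1 ≤ k + 1 by omega)
    gcongr

lemma eulerSum_succ_add_le (n : ℕ) :
    eulerSum (n + 1) + (H (n + 1) + 1) / ((n : ℝ) + 1) ≤ 3 := by
  induction n with
  | zero => norm_num [eulerSum, H]
  | succ n ih =>
    rw [eulerSum_succ, H_succ (n + 1)]
    push_cast
    have h0 := H_nonneg (n + 1)
    have h : (H (n + 1) + 1) / ((n : ℝ) + 1)
        - (H (n + 1) + 1 / ((n : ℝ) + 1 + 1)) / ((n : ℝ) + 1 + 1) ^ 2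
        - (H (n + 1) + 1 / ((n : ℝ) + 1 + 1) + 1) / ((n : ℝ) + 1 + 1)
        = (H (n + 1) + 1 / ((n : ℝ) + 2)) / (((n : ℝ) + 1) * ((n : ℝ) + 2) ^ 2) := by
      field_simp
      ring
    have : 0 ≤ (H (n + 1) + 1 / ((n : ℝ) + 2)) / (((n : ℝ) + 1) * ((n : ℝ) + 2) ^ 2) := by
      positivity
    linarith

/-- The convolution `∑_{k=0}^{n-1} g(k)/(n-k)`. -/
noncomputable def harmonicConv (g : ℕ → ℝ) (n : ℕ) : ℝ := ∑ k ∈ range n, g k / ((n : ℝ) - k)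

lemma sum_Icc_eq_harmonicConv {g : ℕ → ℝ} (hg : g 0 = 0) (n : ℕ) :
    ∑ k ∈ Finset.Icc 1 (n - 1), g k / ((n : ℝ) - (k : ℝ)) = harmonicConv g n := by
  unfold harmonicConv
  refine Finset.sum_subset (fun k hk => ?_) fun k hk hk' => ?_
  · simp only [Finset.mem_Icc, Finset.mem_range] at *
    omega
  · simp only [Finset.mem_Icc, Finset.mem_range] at *
    have : k = 0 := by omega
    simp [this, hg]

lemma harmonicConv_mono {f g : ℕ → ℝ} {n : ℕ} (h : ∀ k < n, f k ≤ g k) : harmonicConv f n ≤ harmonicConv g n := by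
  refine Finset.sum_le_sum fun k hk => ?_
  have hk := Finset.mem_range.1 hk
  have h0 : (0 : ℝ) < (n : ℝ) - k := sub_pos.2 (by exact_mod_cast hk)
  have := h k hk
  gcongr

lemma harmonicConv_succ {g : ℕ → ℝ} (hg : g 0 = 0) (n : ℕ) :
    harmonicConv g (n + 1) = harmonicConv g n + ∑ k ∈ range n, (g (k + 1) - g k) / ((n : ℝ) - k) := by
  unfold harmonicConv
  rw [Finset.sum_range_succ', hg, zero_div, add_zero, ← Finset.sum_add_distrib]
  refine Finset.sum_congr rfl fun k _ => ?_
  push_cast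
  ring

lemma sum_inv_succ (n : ℕ) : ∑ k ∈ range n, 1 / ((k : ℝ) + 1) = H n := by
  induction n with
  | zero => simp [H_zero]
  | succ n ih => rw [Finset.sum_range_succ, ih, H_succ]

lemma sum_inv_sub (n : ℕ) : ∑ k ∈ range n, 1 / ((n : ℝ) - k) = H n := by
  rw [← sum_inv_succ, ← Finset.sum_range_reflect]
  refine Finset.sum_congr rfl fun k hk => ?_
  have hk := Finset.mem_range.1 hk
  rw [Nat.sub_sub, Nat.cast_sub (by omega)]
  push_cast
  ring

lemma sum_inv_succ_mul_inv_sub (n : ℕ) :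
    ∑ k ∈ range n, 1 / ((k : ℝ) + 1) / ((n : ℝ) - k) = 2 * H n / ((n : ℝ) + 1) := by
  have h : ∀ k ∈ range n, 1 / ((k : ℝ) + 1) / ((n : ℝ) - k)
      = (1 / ((k : ℝ) + 1) + 1 / ((n : ℝ) - k)) / ((n : ℝ) + 1) := by
    intro k hk
    have hk := Finset.mem_range.1 hk
    have h0 : (n : ℝ) - k ≠ 0 := (sub_pos.2 (by exact_mod_cast hk)).ne'
    field_simp
    ring
  rw [Finset.sum_congr rfl h, ← Finset.sum_div, Finset.sum_add_distrib, sum_inv_succ,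
    sum_inv_sub]
  ring

lemma harmonicConv_H (n : ℕ) : harmonicConv H n = H n ^ 2 - harmonicSq n := by
  induction n with
  | zero => simp [harmonicConv, H_zero, harmonicSq]
  | succ n ih =>
    have h : ∑ k ∈ range n, (H (k + 1) - H k) / ((n : ℝ) - k) = 2 * H n / ((n : ℝ) + 1) := by
      rw [← sum_inv_succ_mul_inv_sub]
      exact Finset.sum_congr rfl fun k _ => by rw [H_succ, add_sub_cancel_left]
    rw [harmonicConv_succ H_zero, ih, h, harmonicSq_succ, H_succ]
    field_simp
    ring

lemma harmonicConv_H_sq (n : ℕ) :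
    harmonicConv (fun k => H k ^ 2) n = H n ^ 3 - 2 * harmonicSq n * H n + eulerSum n := by
  induction n with
  | zero => simp [harmonicConv, H_zero, eulerSum]
  | succ n ih =>
    have hterm : ∀ k ∈ range n, (H (k + 1) ^ 2 - H k ^ 2) / ((n : ℝ) - k)
        = ((H (k + 1) ^ 2 - H k ^ 2) + 2 * (H (k + 1) / ((n : ℝ) - k))
          - 1 / ((k : ℝ) + 1) / ((n : ℝ) - k)) / ((n : ℝ) + 1) := by
      intro k hk
      have hk := Finset.mem_range.1 hk
      have h0 : (n : ℝ) - k ≠ 0 := (sub_pos.2 (by exact_mod_cast hk)).ne'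
      rw [H_succ]
      field_simp
      ring
    have hconv : ∑ k ∈ range n, H (k + 1) / ((n : ℝ) - k) = harmonicConv H (n + 1) := by
      unfold harmonicConv
      rw [Finset.sum_range_succ', H_zero, zero_div, add_zero]
      exact Finset.sum_congr rfl fun k _ => by push_cast; ring
    have htel : ∑ k ∈ range n, (H (k + 1) ^ 2 - H k ^ 2) = H n ^ 2 := by
      rw [Finset.sum_range_sub (fun k => H k ^ 2), H_zero]
      ring
    rw [harmonicConv_succ (by simp [H_zero]), ih, Finset.sum_congr rfl hterm, ← Finset.sum_div,
      Finset.sum_sub_distrib, Finset.sum_add_distrib, ← Finset.mul_sum, hconv, htel,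
      sum_inv_succ_mul_inv_sub, harmonicConv_H, harmonicSq_succ, eulerSum_succ, H_succ]
    field_simp
    ring

/-- Summation by parts for the harmonic convolution. -/
lemma harmonicConv_eq_sum_sub_mul_H {g : ℕ → ℝ} (hg : g 0 = 0) (n : ℕ) :
    harmonicConv g n = ∑ i ∈ range n, (g (i + 1) - g i) * H (n - 1 - i) := by
  have htel := Finset.sum_range_sub (fun k => g k * H (n - k)) n
  simp only [hg, Nat.sub_self, H_zero, mul_zero, zero_mul, sub_zero] at htel
  rw [eq_comm, ← sub_eq_zero, ← htel]
  unfold harmonicConv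
  rw [← Finset.sum_sub_distrib]
  refine Finset.sum_congr rfl fun k hk => ?_
  have hk := Finset.mem_range.1 hk
  obtain ⟨m, rfl⟩ : ∃ m, n = k + 1 + m := ⟨n - (k + 1), by omega⟩
  rw [show k + 1 + m - 1 - k = m by omega, show k + 1 + m - (k + 1) = m by omega,
    show k + 1 + m - k = m + 1 by omega, H_succ]
  push_cast
  rw [show (k : ℝ) + 1 + m - k = m + 1 by ring]
  ring

lemma H_mul_H_succ_le {m n : ℕ} (h : m ≤ n) : H m * H (n + 1) ≤ H (m + 1) * H n := by
  rw [H_succ, H_succ]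
  have h1 : H m * (1 / ((n : ℝ) + 1)) ≤ H n * (1 / ((m : ℝ) + 1)) := by
    have := H_mono h
    have := H_nonneg m
    gcongr
    exact H_nonneg n
  linarith

/-- Solutions of the selfish recursion are monotone. -/
lemma monotone_of_recursion {g : ℕ → ℝ} (hg0 : g 0 = 0)
    (hg : ∀ n, 1 ≤ n → g n = 1 + harmonicConv g n / H n) : Monotone g := by
  refine monotone_nat_of_le_succ fun n => ?_
  induction n using Nat.strong_induction_on with
  | _ n ih =>
    rcases Nat.eq_zero_or_pos n with rfl | hn
    · rw [hg (0 + 1) le_rfl, hg0]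
      simp [harmonicConv, hg0]
    have hHn := one_le_H hn
    have hHn1 := one_le_H (show 1 ≤ n + 1 by omega)
    rw [hg n hn, hg (n + 1) (by omega), add_le_add_iff_left,
      div_le_div_iff₀ (by linarith) (by linarith), harmonicConv_eq_sum_sub_mul_H hg0,
      harmonicConv_eq_sum_sub_mul_H hg0, Finset.sum_range_succ]
    rw [show n + 1 - 1 - n = 0 by omega, H_zero, mul_zero, add_zero, Finset.sum_mul,
      Finset.sum_mul]
    refine Finset.sum_le_sum fun i hi => ?_
    have hi := Finset.mem_range.1 hi
    rw [mul_assoc, mul_assoc]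
    refine mul_le_mul_of_nonneg_left ?_ (sub_nonneg.2 (ih i hi))
    rw [show n + 1 - 1 - i = (n - 1 - i) + 1 by omega]
    exact H_mul_H_succ_le (by omega)

/-- The right-hand side of the `p`-courteous recursion. -/
noncomputable def courteousStep (p : ℝ) (g : ℕ → ℝ) (n : ℕ) : ℝ :=
  1 + p * g (n - 1) + (1 - p) / H n * harmonicConv g n

lemma courteousStep_mono {p : ℝ} (hp0 : 0 ≤ p) (hp1 : p ≤ 1) {f g : ℕ → ℝ} {n : ℕ}
    (hn : 1 ≤ n) (h : ∀ k < n, f k ≤ g k) : courteousStep p f n ≤ courteousStep p g n := by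
  unfold courteousStep
  have h1 := h (n - 1) (by omega)
  have h2 := harmonicConv_mono h
  have h3 := H_nonneg n
  have h4 : 0 ≤ 1 - p := by linarith
  gcongr

lemma le_of_courteousStep {p : ℝ} (hp0 : 0 ≤ p) (hp1 : p ≤ 1) {f g : ℕ → ℝ} (h0 : f 0 ≤ g 0)
    (hf : ∀ n, 1 ≤ n → f n ≤ courteousStep p f n) (hg : ∀ n, 1 ≤ n → courteousStep p g n ≤ g n)
    (n : ℕ) : f n ≤ g n := by
  induction n using Nat.strong_induction_on with
  | _ n ih =>
    rcases Nat.eq_zero_or_pos n with rfl | hn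
    · exact h0
    · exact (hf n hn).trans ((courteousStep_mono hp0 hp1 hn ih).trans (hg n hn))

/-- An upper bound for the selfish recursion with the sharp leading constant. -/
lemma le_of_selfish {g : ℕ → ℝ} (hg0 : g 0 = 0)
    (hg : ∀ n, 1 ≤ n → g n = courteousStep 0 g n) (n : ℕ) :
    g n ≤ 3 / Real.pi ^ 2 * (H n ^ 2 + 5 * H n) := by
  refine le_of_courteousStep (p := 0) (g := fun n => 3 / Real.pi ^ 2 * (H n ^ 2 + 5 * H n))
    le_rfl zero_le_one (by simp [hg0, H_zero]) (fun n hn => (hg n hn).le) (fun n hn => ?_) n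
  have hconv : harmonicConv (fun n => 3 / Real.pi ^ 2 * (H n ^ 2 + 5 * H n)) n
      = 3 / Real.pi ^ 2 * (harmonicConv (fun k => H k ^ 2) n + 5 * harmonicConv H n) := by
    unfold harmonicConv
    rw [Finset.mul_sum, ← Finset.sum_add_distrib, Finset.mul_sum]
    exact Finset.sum_congr rfl fun k _ => by ring
  have hH := one_le_H hn
  have hH0 : 0 < H n := by linarith
  have hpi : 0 < Real.pi ^ 2 := by positivity
  obtain ⟨m, rfl⟩ : ∃ m, n = m + 1 := ⟨n - 1, by omega⟩
  have hZ := le_harmonicSq_succ_add_inv m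
  have hZ1 := one_le_harmonicSq hn
  have hE := eulerSum_succ_add_le m
  have hE' : 0 ≤ (H (m + 1) + 1) / ((m : ℝ) + 1) := by positivity
  have hHm : 1 / ((m : ℝ) + 1) * H (m + 1) ≤ 1 := by
    have := H_le (m + 1)
    push_cast at this
    rw [one_div_mul_eq_div, div_le_one (by positivity)]
    exact this
  have hmul := mul_le_mul_of_nonneg_right hZ hH0.le
  simp only [courteousStep, hconv, harmonicConv_H, harmonicConv_H_sq]
  have key : 3 / Real.pi ^ 2 * (H (m + 1) ^ 2 + 5 * H (m + 1))
      - (1 + 0 * (3 / Real.pi ^ 2 * (H (m + 1 - 1) ^ 2 + 5 * H (m + 1 - 1)))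
        + (1 - 0) / H (m + 1) * (3 / Real.pi ^ 2 * (H (m + 1) ^ 3
          - 2 * harmonicSq (m + 1) * H (m + 1) + eulerSum (m + 1)
          + 5 * (H (m + 1) ^ 2 - harmonicSq (m + 1)))))
      = 3 / Real.pi ^ 2 / H (m + 1) * (5 * harmonicSq (m + 1) - eulerSum (m + 1)
        - 2 * (Real.pi ^ 2 / 6 * H (m + 1) - harmonicSq (m + 1) * H (m + 1))) := by
    field_simp
    ring
  rw [← sub_nonneg, key]
  refine mul_nonneg (by positivity) ?_
  linarith

lemma le_three_div_pi_sq {c : ℝ} {g : ℕ → ℝ} (hg0 : g 0 = 0)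
    (hg : ∀ n, 1 ≤ n → g n = courteousStep 0 g n) (hc : ∀ n, 40 ≤ n → c * H n ^ 2 ≤ g n) :
    c ≤ 3 / Real.pi ^ 2 := by
  have hlim : Filter.Tendsto (fun n => 3 / Real.pi ^ 2 * (1 + 5 / H n)) Filter.atTop
      (nhds (3 / Real.pi ^ 2 * (1 + 0))) :=
    ((tendsto_H.const_div_atTop 5).const_add 1).const_mul _
  rw [add_zero, mul_one] at hlim
  refine ge_of_tendsto hlim ?_
  filter_upwards [Filter.eventually_ge_atTop 40] with n hn
  have hH := one_le_H (show 1 ≤ n by omega)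
  have h := (hc n hn).trans (le_of_selfish hg0 hg n)
  refine le_of_mul_le_mul_right (h.trans_eq ?_) (show 0 < H n ^ 2 by positivity)
  field_simp

/-- A lower bound for the courteous recursion that is uniform in `p`. -/
lemma le_of_courteous {p : ℝ} (hp0 : 0 ≤ p) (hp1 : p < 1) {g : ℕ → ℝ} (hg0 : g 0 = 0)
    (hg : ∀ n, 1 ≤ n → g n = courteousStep p g n) {n : ℕ} (hn : 1 ≤ n) :
    3 / Real.pi ^ 2 * (H n ^ 2 + H n + 1) ≤ g n := by
  set f : ℕ → ℝ := fun n => 3 / Real.pi ^ 2 * (H n ^ 2 + H n + if n = 0 then 0 else 1) with hf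
  have hpi : 0 < Real.pi ^ 2 := by positivity
  have hpi9 : 9 ≤ Real.pi ^ 2 := by nlinarith [Real.pi_gt_three]
  suffices h : f n ≤ g n by
    simpa [hf, show n ≠ 0 by omega] using h
  refine le_of_courteousStep hp0 hp1.le (by simp [hf, hg0, H_zero]) (fun n hn => ?_)
    (fun n hn => (hg n hn).ge) n
  obtain ⟨m, rfl⟩ : ∃ m, n = m + 1 := ⟨n - 1, by omega⟩
  have hH := one_le_H hn
  have hH0 : 0 < H (m + 1) := by linarith
  have hone : harmonicConv (fun k => if k = 0 then 0 else 1) (m + 1) = H m := by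
    unfold harmonicConv
    rw [Finset.sum_range_succ', ← sum_inv_sub]
    simp
  have hconv : harmonicConv f (m + 1) = 3 / Real.pi ^ 2 * (harmonicConv (fun k => H k ^ 2) (m + 1)
      + harmonicConv H (m + 1) + harmonicConv (fun k => if k = 0 then 0 else 1) (m + 1)) := by
    unfold harmonicConv
    rw [← Finset.sum_add_distrib, ← Finset.sum_add_distrib, Finset.mul_sum]
    exact Finset.sum_congr rfl fun k _ => by simp only [hf]; ring
  have hstep : f (m + 1) - f m ≤ 1 := by
    have ha : 3 / Real.pi ^ 2 ≤ 1 / 3 := by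
      rw [div_le_div_iff₀ hpi (by norm_num)]
      linarith
    have hd : H (m + 1) ^ 2 + H (m + 1) + 1 - (H m ^ 2 + H m + if m = 0 then 0 else 1) ≤ 3 := by
      rcases Nat.eq_zero_or_pos m with rfl | hm
      · norm_num [H]
      · rw [if_neg (by omega), H_succ]
        have hHm := H_le m
        have hm1 : (1 : ℝ) ≤ m := by exact_mod_cast hm
        have ht : 0 < 1 / ((m : ℝ) + 1) := by positivity
        have ht1 : 1 / ((m : ℝ) + 1) * (m + 1) = 1 := by field_simp
        nlinarith
    have hd0 : f (m + 1) - f m = 3 / Real.pi ^ 2 * (H (m + 1) ^ 2 + H (m + 1) + 1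
        - (H m ^ 2 + H m + if m = 0 then 0 else 1)) := by
      simp only [hf, Nat.succ_ne_zero, if_false]
      ring
    rw [hd0]
    have : 0 < 3 / Real.pi ^ 2 := by positivity
    nlinarith
  have hself : f (m + 1) ≤ 1 + harmonicConv f (m + 1) / H (m + 1) := by
    have hZ := harmonicSq_add_inv_succ_le (m + 1)
    have hE := harmonicSq_le_eulerSum (m + 1)
    have hmul := mul_le_mul_of_nonneg_right hZ hH0.le
    push_cast at hmul
    have hm : 1 / ((m : ℝ) + 1) ≤ 2 * (1 / ((m : ℝ) + 1 + 1) * H (m + 1)) := by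
      have h2 : 1 / ((m : ℝ) + 1) ≤ 2 * (1 / ((m : ℝ) + 1 + 1)) := by
        rw [← mul_div_assoc, div_le_div_iff₀ (by positivity) (by positivity)]
        have : (0 : ℝ) ≤ m := by positivity
        linarith
      have h3 : 0 ≤ 1 / ((m : ℝ) + 1 + 1) := by positivity
      nlinarith
    have hHm : H m = H (m + 1) - 1 / ((m : ℝ) + 1) := by rw [H_succ]; ring
    have key : 1 + harmonicConv f (m + 1) / H (m + 1) - f (m + 1)
        = 3 / Real.pi ^ 2 / H (m + 1) * (2 * (Real.pi ^ 2 / 6 * H (m + 1)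
          - harmonicSq (m + 1) * H (m + 1)) + eulerSum (m + 1) - harmonicSq (m + 1)
          - 1 / ((m : ℝ) + 1)) := by
      rw [hconv, harmonicConv_H, harmonicConv_H_sq, hone, hHm]
      simp only [hf, Nat.succ_ne_zero, if_false]
      generalize 1 / ((m : ℝ) + 1) = t
      field_simp
      ring
    rw [← sub_nonneg, key]
    refine mul_nonneg (by positivity) ?_
    linarith
  unfold courteousStep
  rw [Nat.add_sub_cancel]
  have h1 : (1 - p) / H (m + 1) * harmonicConv f (m + 1) = (1 - p) * (harmonicConv f (m + 1) / H (m + 1)) := by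
    ring
  rw [h1]
  nlinarith [mul_le_mul_of_nonneg_left hstep hp0,
    mul_le_mul_of_nonneg_left hself (sub_nonneg.2 hp1.le)]

/-- The upper bound of the courteous process by the selfish one. -/
lemma courteous_le_selfish_div {p : ℝ} (hp0 : 0 ≤ p) (hp1 : p < 1) {g gp : ℕ → ℝ}
    (hg0 : g 0 = 0) (hgp0 : gp 0 = 0) (hg : ∀ n, 1 ≤ n → g n = courteousStep 0 g n)
    (hgp : ∀ n, 1 ≤ n → gp n = courteousStep p gp n) (n : ℕ) : gp n ≤ g n / (1 - p) := by
  have hq : 0 < 1 - p := by linarith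
  have hg' : ∀ n, 1 ≤ n → g n = 1 + harmonicConv g n / H n := fun n hn => by
    rw [hg n hn, courteousStep]
    ring
  refine le_of_courteousStep hp0 hp1.le (g := fun n => g n / (1 - p)) (by simp [hg0, hgp0])
    (fun n hn => (hgp n hn).le) (fun n hn => ?_) n
  have hmono := monotone_of_recursion hg0 hg' (Nat.sub_le n 1)
  have hconv : harmonicConv (fun n => g n / (1 - p)) n = harmonicConv g n / (1 - p) := by
    unfold harmonicConv
    rw [Finset.sum_div]
    exact Finset.sum_congr rfl fun k _ => by ring
  have h1 : courteousStep p (fun n => g n / (1 - p)) n = g n + p * g (n - 1) / (1 - p) := by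
    have hH := one_le_H hn
    rw [courteousStep, hconv, hg' n hn]
    field_simp
    ring
  rw [h1, le_div_iff₀ hq, add_mul, div_mul_cancel₀ _ hq.ne']
  nlinarith [mul_le_mul_of_nonneg_left hmono hp0]

lemma H_div_le {n : ℕ} (hn : 41 ≤ n) : H n / n ≤ 0.105 := by
  induction n, hn using Nat.le_induction with
  | base => norm_num [H, Finset.sum_Icc_succ_top]
  | succ n hn ih =>
    have hn' : (41 : ℝ) ≤ n := by exact_mod_cast hn
    have h1 := one_le_H (show 1 ≤ n by omega)
    rw [div_le_iff₀ (by linarith)] at ih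
    rw [H_succ]
    push_cast
    rw [div_le_iff₀ (by linarith)]
    have : 1 / ((n : ℝ) + 1) ≤ 1 / 42 := by gcongr; linarith
    linarith

lemma sum_H_sq_div_le {n : ℕ} (hn : 41 ≤ n) :
    (∑ k ∈ range 40, H k ^ 2 / ((n : ℝ) - k)) / H n ≤ 11.7 := by
  have hmono : ∑ k ∈ range 40, H k ^ 2 / ((n : ℝ) - k)
      ≤ ∑ k ∈ range 40, H k ^ 2 / (((41 : ℕ) : ℝ) - k) := by
    refine Finset.sum_le_sum fun k hk => ?_
    have hk := Finset.mem_range.1 hk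
    have h0 : (0 : ℝ) < ((41 : ℕ) : ℝ) - k := sub_pos.2 (by exact_mod_cast (by omega))
    have hn' : ((41 : ℕ) : ℝ) ≤ n := by exact_mod_cast hn
    gcongr
  have hconv : ∑ k ∈ range 40, H k ^ 2 / (((41 : ℕ) : ℝ) - k)
      = harmonicConv (fun k => H k ^ 2) 41 - H 40 ^ 2 := by
    unfold harmonicConv
    rw [Finset.sum_range_succ _ 40]
    norm_num
  rw [hconv, harmonicConv_H_sq] at hmono
  have hE := eulerSum_succ_add_le 40
  have hZ : 1.62 ≤ harmonicSq 41 := by norm_num [harmonicSq, Finset.sum_range_succ]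
  have hHl : 4.3029 ≤ H 41 := by norm_num [H, Finset.sum_Icc_succ_top]
  have hHu : H 41 ≤ 4.303 := by norm_num [H, Finset.sum_Icc_succ_top]
  have hH40 : 4.2785 ≤ H 40 := by norm_num [H, Finset.sum_Icc_succ_top]
  have hHn := H_mono hn
  norm_num at hE
  rw [div_le_iff₀ (by linarith)]
  have h1 : H 41 ^ 2 ≤ 4.303 ^ 2 := by gcongr
  have h2 : (4.2785 : ℝ) ^ 2 ≤ H 40 ^ 2 := by gcongr
  nlinarith

/-- On the initial segment the uniform lower bound dominates a multiple of `H_k²`. -/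
lemma mul_H_sq_le_of_courteous {p : ℝ} (hp0 : 0 ≤ p) (hp1 : p < 1) {g : ℕ → ℝ} (hg0 : g 0 = 0)
    (hg : ∀ n, 1 ≤ n → g n = courteousStep p g n) {k : ℕ} (hk : k < 40) :
    0.392 * H k ^ 2 ≤ g k := by
  rcases Nat.eq_zero_or_pos k with rfl | hk0
  · simp [H_zero, hg0]
  refine le_trans ?_ (le_of_courteous hp0 hp1 hg0 hg hk0)
  have hpi : Real.pi ^ 2 ≤ 9.8697 := by nlinarith [Real.pi_lt_d4, Real.pi_pos]
  have ha : 0.30396 ≤ 3 / Real.pi ^ 2 := by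
    rw [le_div_iff₀ (by positivity)]
    nlinarith
  have h39 : H 39 ≤ 4.2544 := by norm_num [H, Finset.sum_Icc_succ_top]
  have hu : H k ≤ 4.2544 := (H_mono (show k ≤ 39 by omega)).trans h39
  have hl := one_le_H hk0
  have h : 0.392 * H k ^ 2 ≤ 0.30396 * (H k ^ 2 + H k + 1) := by nlinarith
  exact h.trans (mul_le_mul_of_nonneg_right ha (by positivity))

/-- The lower bound is preserved by the courteous recursion beyond `40`. -/
lemma mul_H_sq_le_step {p c A : ℝ} (hp0 : 0 ≤ p) (hp1 : p < 1) (hc : 0 < c)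
    (hcle : c ≤ 3 / Real.pi ^ 2) (hA : A * (0.214 * p + (1 - p) / c) = 4 / 9)
    {g : ℕ → ℝ} (hsmall : ∀ k < 40, 0.392 * H k ^ 2 ≤ g k) {n : ℕ} (hn : 41 ≤ n)
    (ih : ∀ k, 40 ≤ k → k < n → A * H k ^ 2 ≤ g k) :
    A * H n ^ 2 ≤ courteousStep p g n := by
  have hq : 0 < 1 - p := by linarith
  have hpi : 9.869 ≤ Real.pi ^ 2 := by nlinarith [Real.pi_gt_d4]
  have hcinv : Real.pi ^ 2 / 3 ≤ 1 / c := by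
    rw [le_div_iff₀ (by positivity)] at hcle
    rw [div_le_div_iff₀ (by norm_num) hc]
    linarith
  have hqc : (1 - p) * (Real.pi ^ 2 / 3) ≤ (1 - p) / c := by
    rw [div_eq_mul_one_div (1 - p) c]
    gcongr
  have hden : 0 < 0.214 * p + (1 - p) / c := by positivity
  have hA0 : 0 < A := by
    by_contra! h
    nlinarith
  set m := min 0.392 A with hm
  have hmA : m ≤ A := min_le_right _ _
  have hlow : ∀ k < n, (if k < 40 then m else A) * H k ^ 2 ≤ g k := by
    intro k hk
    split_ifs with h
    · exact (mul_le_mul_of_nonneg_right (min_le_left _ _) (sq_nonneg _)).trans (hsmall k h)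
    · exact ih k (by omega) hk
  refine le_trans ?_ (courteousStep_mono hp0 hp1.le (by omega) hlow)
  have hconv : harmonicConv (fun k => (if k < 40 then m else A) * H k ^ 2) n
      = A * harmonicConv (fun k => H k ^ 2) n
        - (A - m) * ∑ k ∈ range 40, H k ^ 2 / ((n : ℝ) - k) := by
    have hsub : range 40 = (range n).filter (· < 40) := by
      ext k
      simp only [Finset.mem_range, Finset.mem_filter]
      omega
    unfold harmonicConv
    rw [hsub, Finset.sum_filter, Finset.mul_sum, Finset.mul_sum, ← Finset.sum_sub_distrib]
    refine Finset.sum_congr rfl fun k _ => ?_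
    beta_reduce
    split_ifs <;> ring
  have hH := one_le_H (show 1 ≤ n by omega)
  have hH0 : 0 < H n := by linarith
  have hD := sum_H_sq_div_le hn
  set D := (∑ k ∈ range 40, H k ^ 2 / ((n : ℝ) - k)) / H n with hDdef
  have hZ := harmonicSq_le n
  have hE : 0 ≤ eulerSum n / H n := div_nonneg (eulerSum_nonneg n) hH0.le
  have hdiff : H n ^ 2 - H (n - 1) ^ 2 ≤ 0.214 := by
    have h := H_div_le hn
    obtain ⟨j, rfl⟩ : ∃ j, n = j + 1 := ⟨n - 1, by omega⟩
    have hj : H j = H (j + 1) - 1 / ((j : ℝ) + 1) := by rw [H_succ]; ring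
    rw [Nat.add_sub_cancel, hj]
    push_cast at h
    have heq : H (j + 1) ^ 2 - (H (j + 1) - 1 / ((j : ℝ) + 1)) ^ 2
        = 2 * (H (j + 1) / ((j : ℝ) + 1)) - (1 / ((j : ℝ) + 1)) ^ 2 := by ring
    rw [heq]
    nlinarith [sq_nonneg (1 / ((j : ℝ) + 1))]
  have hdef : (1 - p) * ((A - m) * 11.7) ≤ 5 / 9 := by
    rcases le_total A 0.392 with h | h
    · rw [hm, min_eq_right h]
      norm_num
    · rw [hm, min_eq_left h]
      have hAle : A * (0.214 * p + (1 - p) * 3.2896) ≤ 4 / 9 := by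
        rw [← hA]
        gcongr
        nlinarith
      have hden' : 0 < 0.214 * p + (1 - p) * 3.2896 := by positivity
      refine le_of_mul_le_mul_right ?_ hden'
      nlinarith [mul_le_mul_of_nonneg_left hAle hq.le, sq_nonneg ((1 - p) - 0.089)]
  have hstep : courteousStep p (fun k => (if k < 40 then m else A) * H k ^ 2) n
      = A * H n ^ 2 + (1 - p * (A * (H n ^ 2 - H (n - 1) ^ 2))
        - (1 - p) * (A * (2 * harmonicSq n)) + (1 - p) * (A * (eulerSum n / H n))
        - (1 - p) * ((A - m) * D)) := by
    rw [courteousStep, hconv, harmonicConv_H_sq, hDdef, if_neg (show ¬ n - 1 < 40 by omega)]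
    field_simp
    ring
  rw [hstep]
  have e1 : p * (A * (H n ^ 2 - H (n - 1) ^ 2)) ≤ p * (A * 0.214) := by gcongr
  have e2 : (1 - p) * (A * (2 * harmonicSq n)) ≤ (1 - p) * (A * (2 * (Real.pi ^ 2 / 6))) := by
    gcongr
  have e3 : 0 ≤ (1 - p) * (A * (eulerSum n / H n)) := by positivity
  have e4 : (1 - p) * ((A - m) * D) ≤ (1 - p) * ((A - m) * 11.7) := by
    have : 0 ≤ A - m := by linarith
    gcongr
  have e5 := mul_le_mul_of_nonneg_left hqc hA0.le
  linarith

theorem stmt_18 (p c₁ c₂ : ℝ) (hp0 : 0 ≤ p) (hp1 : p < 1)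
    (hc₁ : 0 < c₁) (hc₂ : 0 < c₂) (hc₁4 : c₁ < 4)
    (R Rp : ℕ → ℝ) (hR1 : R 1 = 1)
    (hRrec : ∀ n : ℕ, 2 ≤ n →
      R n = 1 + (1 / H n) * ∑ k ∈ Finset.Icc 1 (n - 1), R k / ((n : ℝ) - (k : ℝ)))
    (hRp0 : Rp 0 = 0)
    (hRprec : ∀ n : ℕ, 1 ≤ n →
      Rp n = 1 + p * Rp (n - 1) +
        ((1 - p) / H n) * ∑ k ∈ Finset.Icc 1 (n - 1), Rp k / ((n : ℝ) - (k : ℝ)))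
    (hRbounds : ∀ n : ℕ, 40 ≤ n → c₁ * H n ^ 2 ≤ R n ∧ R n ≤ c₂ * H n ^ 2)
    (hbase : ((4 * c₁ / 9) / (1 - (1 - 0.214 * c₁) * p)) * H 40 ^ 2 ≤ Rp 40 ∧
      Rp 40 ≤ (c₂ / (1 - p)) * H 40 ^ 2) :
    ∀ n : ℕ, 40 ≤ n →
      ((4 * c₁ / 9) / (1 - (1 - 0.214 * c₁) * p)) * H n ^ 2 ≤ Rp n ∧
      Rp n ≤ (c₂ / (1 - p)) * H n ^ 2 := by
  have hq : 0 < 1 - p := by linarith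
  set g : ℕ → ℝ := fun k => if k = 0 then 0 else R k with hgdef
  have hg0 : g 0 = 0 := by simp [hgdef]
  have hgR : ∀ n, 1 ≤ n → g n = R n := fun n hn => by simp [hgdef, show n ≠ 0 by omega]
  have hg : ∀ n, 1 ≤ n → g n = courteousStep 0 g n := by
    intro n hn
    rcases hn.eq_or_lt with rfl | hn2
    · rw [hgR 1 le_rfl, hR1]
      simp [courteousStep, harmonicConv, hg0]
    · have hsum : ∑ k ∈ Finset.Icc 1 (n - 1), R k / ((n : ℝ) - (k : ℝ)) = harmonicConv g n := by
        rw [← sum_Icc_eq_harmonicConv hg0]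
        exact Finset.sum_congr rfl fun k hk => by rw [hgR k (Finset.mem_Icc.1 hk).1]
      rw [hgR n hn, hRrec n hn2, hsum, courteousStep]
      ring
  have hgp : ∀ n, 1 ≤ n → Rp n = courteousStep p Rp n := fun n hn => by
    rw [hRprec n hn, sum_Icc_eq_harmonicConv hRp0, courteousStep]
  have hcle : c₁ ≤ 3 / Real.pi ^ 2 := le_three_div_pi_sq hg0 hg fun n hn => by
    rw [hgR n (by omega)]
    exact (hRbounds n hn).1
  have hden : 0 < 1 - (1 - 0.214 * c₁) * p := by nlinarith [mul_nonneg hc₁.le hp0]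
  have hA : (4 * c₁ / 9) / (1 - (1 - 0.214 * c₁) * p) * (0.214 * p + (1 - p) / c₁) = 4 / 9 := by
    have h : 0.214 * p + (1 - p) / c₁ = (1 - (1 - 0.214 * c₁) * p) / c₁ := by
      field_simp
      ring
    rw [h, div_mul_div_cancel₀ hden.ne']
    field_simp
  intro n hn
  constructor
  · induction n using Nat.strong_induction_on with
    | _ n ih =>
      rcases hn.eq_or_lt with rfl | hn41
      · exact hbase.1
      · rw [hgp n (by omega)]
        exact mul_H_sq_le_step hp0 hp1 hc₁ hcle hA
          (fun k hk => mul_H_sq_le_of_courteous hp0 hp1 hRp0 hgp hk) hn41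
          fun k hk hkn => ih k hkn hk
  · calc Rp n ≤ g n / (1 - p) := courteous_le_selfish_div hp0 hp1 hg0 hRp0 hg hgp n
      _ ≤ c₂ * H n ^ 2 / (1 - p) := by
        rw [hgR n (by omega)]
        exact div_le_div_of_nonneg_right (hRbounds n hn).2 hq.le
      _ = c₂ / (1 - p) * H n ^ 2 := by ring
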